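/- arXiv:2402.14649 — 2 statements merged into one kernel-verified Lean document; each statement's English description precedes it below -/
import Mathlib

section
/- Let X and A be nonempty finite types, L a finite type, and K : L → Matrix (X × A) X ℂ a Kraus family with ∑ l, (K l)ᴴ * K l = 1; let γ(ρ) = ∑ l, K l * ρ * (K l)ᴴ be the associated quantum channel. Then Tr_A(γ(ρ)) = ρ for every density operator ρ on X if and only if there exists ξ : Matrix A A ℂ with ξ.PosSemidef and Matrix.trace ξ = 1 such that γ(ρ) = ρ ⊗ₖ ξ for every density operator ρ on X. (Structure of open-loop quantum policies: such channels are exactly the appending channels.) -/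
open Matrix
open scoped ComplexOrder
open scoped Kronecker

/-- A density operator on a finite type `S`: positive semidefinite with unit trace. -/
def IsDensity {S : Type*} [Fintype S] (ρ : Matrix S S ℂ) : Prop :=
  ρ.PosSemidef ∧ ρ.trace = 1

/-- Partial trace over the `A`-factor of a matrix on `X × A`. -/
noncomputable def ptraceA {X A : Type*} [Fintype A] (M : Matrix (X × A) (X × A) ℂ) :
    Matrix X X ℂ :=
  Matrix.of fun x y => ∑ a, M (x, a) (y, a)

theorem aux_entry {X A L : Type*} [Fintype X] [Fintype A] [Fintype L]
    (K : L → Matrix (X × A) X ℂ)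
    (h : ∀ ρ : Matrix X X ℂ, IsDensity ρ → ptraceA (∑ l, K l * ρ * (K l)ᴴ) = ρ)
    (v : X → ℂ) (hv : v ≠ 0) (x y : X) :
    ∑ a, ∑ l, (K l *ᵥ v) (x, a) * star ((K l *ᵥ v) (y, a)) = v x * star (v y) := by
  have hpos : 0 < v ⬝ᵥ star v := dotProduct_self_star_pos_iff.mpr hv
  set c : ℂ := (v ⬝ᵥ star v)⁻¹ with hc
  have hcne : c ≠ 0 := inv_ne_zero hpos.ne'
  have hd : IsDensity (c • vecMulVec v (star v)) := by
    refine ⟨(posSemidef_vecMulVec_self_star v).smul ?_, ?_⟩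
    · exact (inv_pos.mpr hpos).le
    · rw [trace_smul, trace_vecMulVec, smul_eq_mul, hc, inv_mul_cancel₀ hpos.ne']
  have h1 := congrFun (congrFun (h _ hd) x) y
  have h2 : ∀ l, K l * (c • vecMulVec v (star v)) * (K l)ᴴ
      = c • vecMulVec (K l *ᵥ v) (star (K l *ᵥ v)) := by
    intro l
    rw [Matrix.mul_smul, Matrix.smul_mul, mul_vecMulVec, vecMulVec_mul, star_mulVec]
  simp only [h2, ptraceA, Matrix.of_apply, Matrix.sum_apply, Matrix.smul_apply, vecMulVec_apply,
    smul_eq_mul, Pi.star_apply, ← Finset.mul_sum] at h1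
  exact mul_left_cancel₀ hcne h1

theorem aux_orth {X A L : Type*} [Fintype X] [Fintype A] [Fintype L]
    (K : L → Matrix (X × A) X ℂ)
    (h : ∀ ρ : Matrix X X ℂ, IsDensity ρ → ptraceA (∑ l, K l * ρ * (K l)ᴴ) = ρ)
    (v u : X → ℂ) (hv : v ≠ 0) (huv : ∑ x, u x * v x = 0) (l : L) (a : A) :
    ∑ x, u x * (K l *ᵥ v) (x, a) = 0 := by
  have key : ∑ a, ∑ l, (∑ x, u x * (K l *ᵥ v) (x, a)) * star (∑ x, u x * (K l *ᵥ v) (x, a)) = 0 := by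
    calc _ = ∑ x, ∑ y, u x * star (u y) *
          ∑ a, ∑ l, (K l *ᵥ v) (x, a) * star ((K l *ᵥ v) (y, a)) := by
          have e : ∀ w : X → ℂ, (∑ x, u x * w x) * star (∑ x, u x * w x)
              = ∑ x, ∑ y, u x * star (u y) * (w x * star (w y)) := by
            intro w
            rw [star_sum, Finset.sum_mul_sum]
            refine Finset.sum_congr rfl fun x _ => Finset.sum_congr rfl fun y _ => ?_
            rw [star_mul']; ring
          have e2 : ∀ (a : A) (l : L), _ := fun a l => e (fun x => (K l *ᵥ v) (x, a))
          simp only [e2]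
          simp only [Finset.mul_sum]
          rw [← Fintype.sum_prod_type', Finset.sum_comm]
          refine Finset.sum_congr rfl fun x _ => ?_
          rw [Finset.sum_comm]
          refine Finset.sum_congr rfl fun y _ => ?_
          rw [Fintype.sum_prod_type]
      _ = (∑ x, u x * v x) * star (∑ x, u x * v x) := by
          simp only [aux_entry K h v hv, star_sum, Finset.sum_mul_sum]
          refine Finset.sum_congr rfl fun x _ => Finset.sum_congr rfl fun y _ => ?_
          rw [star_mul']; ring
      _ = 0 := by rw [huv, zero_mul]
  have k1 := (Finset.sum_eq_zero_iff_of_nonneg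
    (fun a _ => Finset.sum_nonneg fun l _ => mul_star_self_nonneg _)).mp key a (Finset.mem_univ _)
  have k2 := (Finset.sum_eq_zero_iff_of_nonneg
    (fun l _ => mul_star_self_nonneg _)).mp k1 l (Finset.mem_univ _)
  rcases mul_eq_zero.mp k2 with k | k
  · exact k
  · exact star_eq_zero.mp k

theorem aux_scalar {X A L : Type*} [Fintype X] [DecidableEq X] [Fintype A] [Fintype L]
    (K : L → Matrix (X × A) X ℂ)
    (h : ∀ ρ : Matrix X X ℂ, IsDensity ρ → ptraceA (∑ l, K l * ρ * (K l)ᴴ) = ρ)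
    (x₀ : X) (l : L) (a : A) (x y : X) :
    K l (x, a) y = if x = y then K l (x₀, a) x₀ else 0 := by
  have off : ∀ x y, x ≠ y → K l (x, a) y = 0 := by
    intro x y hxy
    have := aux_orth K h (Pi.single y 1) (Pi.single x 1) (by simp)
      (by simp [Pi.single_apply, Ne.symm hxy]) l a
    simpa [Pi.single_apply] using this
  split_ifs with hxy
  · subst hxy
    by_cases hx : x = x₀
    · rw [hx]
    have := aux_orth K h (Pi.single x 1 + Pi.single x₀ 1) (Pi.single x 1 - Pi.single x₀ 1)
      (by
        intro h0
        have := congrFun h0 x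
        simp [Pi.single_apply, hx] at this)
      (by simp [Pi.single_apply, hx, Ne.symm hx, sub_mul, mul_add, Finset.sum_add_distrib]) l a
    simp [Pi.single_apply, mulVec_add, sub_mul, mul_add, Finset.sum_add_distrib,
      off x x₀ hx, off x₀ x (Ne.symm hx)] at this
    exact sub_eq_zero.mp this
  · exact off x y hxy

/-- Structure of open-loop quantum policies: a quantum channel is reversed by the
partial trace on all density operators iff it is an appending channel
`ρ ↦ ρ ⊗ ξ`. -/
theorem open_loop_policy_structure
    (X A : Type*) [Fintype X] [DecidableEq X] [Nonempty X]
    [Fintype A] [DecidableEq A] [Nonempty A]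
    (L : Type*) [Fintype L]
    (K : L → Matrix (X × A) X ℂ)
    (hK : ∑ l, (K l)ᴴ * K l = 1)
    (γ : Matrix X X ℂ → Matrix (X × A) (X × A) ℂ)
    (hγ : ∀ ρ, γ ρ = ∑ l, K l * ρ * (K l)ᴴ) :
    (∀ ρ : Matrix X X ℂ, IsDensity ρ → ptraceA (γ ρ) = ρ) ↔
    (∃ ξ : Matrix A A ℂ, ξ.PosSemidef ∧ ξ.trace = 1 ∧
      ∀ ρ : Matrix X X ℂ, IsDensity ρ → γ ρ = ρ ⊗ₖ ξ) := by
  have hγ' : γ = fun ρ => ∑ l, K l * ρ * (K l)ᴴ := funext hγ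
  subst hγ'
  constructor
  · intro h
    obtain ⟨x₀⟩ := ‹Nonempty X›
    have hs := aux_scalar K h x₀
    refine ⟨∑ l, vecMulVec (fun a => K l (x₀, a) x₀) (star fun a => K l (x₀, a) x₀),
      posSemidef_sum _ fun l _ => posSemidef_vecMulVec_self_star _, ?_, ?_⟩
    · have h1 := congrFun (congrFun hK x₀) x₀
      rw [Matrix.one_apply_eq] at h1
      rw [← h1, trace_sum, Matrix.sum_apply]
      refine Finset.sum_congr rfl fun l _ => ?_
      rw [Matrix.mul_apply, Fintype.sum_prod_type, Finset.sum_eq_single x₀]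
      · simp [Matrix.trace, vecMulVec_apply, mul_comm]
      · intro x _ hx
        refine Finset.sum_eq_zero fun a _ => ?_
        rw [hs l a x x₀, if_neg hx, mul_zero]
      · simp
    · intro ρ _
      ext ⟨x, a⟩ ⟨y, b⟩
      simp only [kroneckerMap_apply, Matrix.sum_apply, Finset.mul_sum, vecMulVec_apply]
      refine Finset.sum_congr rfl fun l _ => ?_
      simp only [Matrix.mul_apply, conjTranspose_apply, hs l a x, hs l b y]
      simp [apply_ite]
      ring
  · rintro ⟨ξ, _, ht, h⟩ ρ hρ
    rw [h ρ hρ]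
    ext x y
    simp only [ptraceA, Matrix.of_apply, kroneckerMap_apply, ← Finset.mul_sum]
    have : ∑ a, ξ a a = 1 := ht
    rw [this, mul_one]
end

section
/- Let X be a nonempty finite type, ψ : X → ℂ, K a finite type, and ξ : K → (X → ℂ) a family of vectors such that Matrix.vecMulVec ψ (star ψ) = ∑ k, Matrix.vecMulVec (ξ k) (star (ξ k)). Then for every k : K there exists c : ℂ with ξ k = c • ψ; that is, any decomposition of a rank-one state |ψ⟩⟨ψ| as a finite sum of rank-one terms consists of vectors proportional to ψ. -/
open Matrix

/-- Any decomposition of a rank-one state `|ψ⟩⟨ψ|` as a finite sum of rank-one terms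
consists of vectors proportional to `ψ`. -/
theorem rank_one_decomposition_proportional
    (X : Type*) [Fintype X] [Nonempty X]
    (ψ : X → ℂ)
    (K : Type*) [Fintype K]
    (ξ : K → (X → ℂ))
    (h : Matrix.vecMulVec ψ (star ψ) = ∑ k, Matrix.vecMulVec (ξ k) (star (ξ k))) :
    ∀ k : K, ∃ c : ℂ, ξ k = c • ψ := by
  have he : ∀ x y, ψ x * star (ψ y) = ∑ k, ξ k x * star (ξ k y) := by
    intro x y
    have := congrFun (congrFun h x) y
    simpa [Matrix.sum_apply, Matrix.vecMulVec_apply] using this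
  have key : ∀ f : K → ℂ, ∑ k, f k * star (f k) = 0 → ∀ k, f k = 0 := by
    intro f hf k
    have h1 : ∑ k, Complex.normSq (f k) = 0 := by
      have h2 : ((∑ k, Complex.normSq (f k) : ℝ) : ℂ) = 0 := by
        rw [← hf]
        push_cast
        exact Finset.sum_congr rfl fun k _ => (Complex.mul_conj (f k)).symm
      exact_mod_cast h2
    rw [Finset.sum_eq_zero_iff_of_nonneg (fun _ _ => Complex.normSq_nonneg _)] at h1
    exact Complex.normSq_eq_zero.mp (h1 k (Finset.mem_univ k))
  intro k
  by_cases h0 : ∃ x, ψ x ≠ 0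
  · obtain ⟨x, hx⟩ := h0
    refine ⟨ξ k x / ψ x, ?_⟩
    funext y
    have h3 := key (fun k => ψ x * ξ k y - ψ y * ξ k x) (by
      have e : ∀ k, (ψ x * ξ k y - ψ y * ξ k x) * star (ψ x * ξ k y - ψ y * ξ k x)
          = ψ x * star (ψ x) * (ξ k y * star (ξ k y))
            - ψ x * star (ψ y) * (ξ k y * star (ξ k x))
            - ψ y * star (ψ x) * (ξ k x * star (ξ k y))
            + ψ y * star (ψ y) * (ξ k x * star (ξ k x)) := by
        intro k
        simp only [star_sub, star_mul]
        ring
      simp only [e, Finset.sum_add_distrib, Finset.sum_sub_distrib, ← Finset.mul_sum, ← he]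
      ring) k
    simp only [Pi.smul_apply, smul_eq_mul]
    field_simp
    linear_combination h3
  · push Not at h0
    refine ⟨0, ?_⟩
    funext y
    have h3 := key (fun k => ξ k y) (by rw [← he, h0 y]; simp) k
    simpa using h3
end
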